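/- Let S be a numerical semigroup. Then: (1) minAp(S) = minAp_M(S); (2) maxAp(S) ⊆ maxAp_M(S); (3) S is M-pure if and only if S is pure and maxAp(S) = maxAp_M(S). -/

import Mathlib

namespace GotoNS

/-- `S` is a numerical semigroup: an additive submonoid of `ℕ` with finite
complement, different from `ℕ` itself. -/
def IsNumericalSemigroup (S : Set ℕ) : Prop :=
  (0 : ℕ) ∈ S ∧ (∀ a b, a ∈ S → b ∈ S → a + b ∈ S) ∧ Sᶜ.Finite ∧ S ≠ Set.univ

/-- The multiplicity `e` of `S`: its smallest nonzero element. -/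
noncomputable def mult (S : Set ℕ) : ℕ := sInf {n | n ∈ S ∧ n ≠ 0}

/-- The Frobenius number `f` of `S`: the largest integer not in `S`. -/
noncomputable def frob (S : Set ℕ) : ℕ := sSup {n | n ∉ S}

/-- The `k`-fold sumset `kM` of `M = S \ {0}` (with `0M = {0}`). -/
def kfold (S : Set ℕ) (k : ℕ) : Set ℕ :=
  {s | ∃ c : Fin k → ℕ, (∀ i, c i ∈ S ∧ c i ≠ 0) ∧ ∑ i, c i = s}

/-- The order of `s`: the largest `k` such that `s` is a sum of `k` nonzero
elements of `S` (`ord 0 = 0`; junk value `0` off `S`). -/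
noncomputable def ordS (S : Set ℕ) (s : ℕ) : ℕ := sSup {k | s ∈ kfold S k}

/-- The Apéry set `Ap(S; n) = {w ∈ S | w - n ∉ S}`. -/
def apery (S : Set ℕ) (n : ℕ) : Set ℕ := {w | w ∈ S ∧ ∀ s ∈ S, s + n ≠ w}

/-- `σ(α) = max {ord w | w ∈ Ap(S; α)}`. -/
noncomputable def sigmaS (S : Set ℕ) (α : ℕ) : ℕ := sSup (ordS S '' apery S α)

/-- `𝒜(u) = {α ∈ {1, …, e} | u - α ∈ S}`. -/
def Aset (S : Set ℕ) (u : ℕ) : Set ℕ :=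
  {α | 1 ≤ α ∧ α ≤ mult S ∧ ∃ s ∈ S, s + α = u}

/-- The Goto number `g(u) = min {σ(α) | α ∈ 𝒜(u)}`. -/
noncomputable def goto (S : Set ℕ) (u : ℕ) : ℕ := sInf (sigmaS S '' Aset S u)

/-- `τ`: the minimal Goto number of a nonzero element of `S`. -/
noncomputable def tau (S : Set ℕ) : ℕ := sInf (goto S '' {u | u ∈ S ∧ u ≠ 0})

/-- `ρ`: the maximal Goto number of a nonzero element of `S`. -/
noncomputable def rho (S : Set ℕ) : ℕ := sSup (goto S '' {u | u ∈ S ∧ u ≠ 0})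

/-- An integer belongs to `S` (viewed inside `ℤ`). -/
def memZ (S : Set ℕ) (z : ℤ) : Prop := ∃ n : ℕ, n ∈ S ∧ (n : ℤ) = z

/-- `T = {z ∈ ℤ \ S | z + u ∈ S for all 0 ≠ u ∈ S}`. -/
def Tset (S : Set ℕ) : Set ℤ :=
  {z | ¬ memZ S z ∧ ∀ u : ℕ, u ∈ S → u ≠ 0 → memZ S (z + (u : ℤ))}

open Classical in
/-- The order of an integer, with the convention `ord z = -1` if `z ∉ S`. -/
noncomputable def ordZ (S : Set ℕ) (z : ℤ) : ℤ :=
  if 0 ≤ z ∧ z.toNat ∈ S then (ordS S z.toNat : ℤ) else -1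

/-- `S` is symmetric: for integers `x + y = f`, exactly one of `x, y` lies in `S`. -/
def IsSymmetricNS (S : Set ℕ) : Prop :=
  ∀ x y : ℤ, x + y = (frob S : ℤ) → (memZ S x ↔ ¬ memZ S y)

/-- `u ⪯ u'` iff `u' - u ∈ S`. -/
def preceq (S : Set ℕ) (u u' : ℕ) : Prop := ∃ s ∈ S, u + s = u'

/-- `u ⪯_M u'` iff `u + s = u'` and `ord u + ord s = ord u'` for some `s ∈ S`. -/
def preceqM (S : Set ℕ) (u u' : ℕ) : Prop :=
  ∃ s ∈ S, u + s = u' ∧ ordS S u + ordS S s = ordS S u'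

/-- `Ap(S) \ {0}`. -/
def apNZ (S : Set ℕ) : Set ℕ := apery S (mult S) \ {0}

/-- Minimal elements of `Ap(S) \ {0}` with respect to `⪯`. -/
def minAp (S : Set ℕ) : Set ℕ := {w | w ∈ apNZ S ∧ ∀ w' ∈ apNZ S, preceq S w' w → w' = w}

/-- Maximal elements of `Ap(S) \ {0}` with respect to `⪯`. -/
def maxAp (S : Set ℕ) : Set ℕ := {w | w ∈ apNZ S ∧ ∀ w' ∈ apNZ S, preceq S w w' → w' = w}

/-- Minimal elements of `Ap(S) \ {0}` with respect to `⪯_M`. -/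
def minApM (S : Set ℕ) : Set ℕ := {w | w ∈ apNZ S ∧ ∀ w' ∈ apNZ S, preceqM S w' w → w' = w}

/-- Maximal elements of `Ap(S) \ {0}` with respect to `⪯_M`. -/
def maxApM (S : Set ℕ) : Set ℕ := {w | w ∈ apNZ S ∧ ∀ w' ∈ apNZ S, preceqM S w w' → w' = w}

/-- `S` is pure if all elements of `maxAp S` have the same order. -/
def IsPure (S : Set ℕ) : Prop := ∀ w ∈ maxAp S, ∀ w' ∈ maxAp S, ordS S w = ordS S w'

/-- `S` is `M`-pure if all elements of `maxApM S` have the same order. -/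
def IsMPure (S : Set ℕ) : Prop := ∀ w ∈ maxApM S, ∀ w' ∈ maxApM S, ordS S w = ordS S w'

/-- `S` is `M`-additive if `ord (u + a₁) = ord u + 1` for all `u ∈ S`. -/
def IsMAdditive (S : Set ℕ) : Prop := ∀ u ∈ S, ordS S (u + mult S) = ordS S u + 1

/-- The reduction number `r = min {k | (k+1)M = a₁ + kM}`. -/
noncomputable def redNum (S : Set ℕ) : ℕ :=
  sInf {k | kfold S (k + 1) = (fun x => mult S + x) '' kfold S k}

/-- The set of minimal generators of `S`: nonzero elements of `S` that are not
sums of two nonzero elements of `S`. -/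
def minGens (S : Set ℕ) : Set ℕ :=
  {a | a ∈ S ∧ a ≠ 0 ∧ ∀ x ∈ S, ∀ y ∈ S, x ≠ 0 → y ≠ 0 → x + y ≠ a}

/-- `δ_w = max {ord w + ord w' | w' ∈ S, w + w' ∈ Ap(S)}`. -/
noncomputable def deltaI (S : Set ℕ) (w : ℕ) : ℕ :=
  sSup ((fun w' => ordS S w + ordS S w') '' {w' | w' ∈ S ∧ w + w' ∈ apery S (mult S)})

/-- `δ = min {δ_w | w ∈ Ap(S)}`. -/
noncomputable def deltaNS (S : Set ℕ) : ℕ := sInf (deltaI S '' apery S (mult S))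

/-- `γ_w = max {ord w + ⌊w'/a₁⌋ | w' ∈ S, w + w' ∈ Ap(S)}`. -/
noncomputable def gammaI (S : Set ℕ) (w : ℕ) : ℕ :=
  sSup ((fun w' => ordS S w + w' / mult S) '' {w' | w' ∈ S ∧ w + w' ∈ apery S (mult S)})

/-- `γ = min {γ_w | w ∈ Ap(S)}`. -/
noncomputable def gammaNS (S : Set ℕ) : ℕ := sInf (gammaI S '' apery S (mult S))

/-- `ord(C) = min {ord (f+1), …, ord (f+a₁)}`. -/
noncomputable def ordC (S : Set ℕ) : ℕ :=
  sInf ((fun α => ordS S (frob S + α)) '' Set.Icc 1 (mult S))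

section

variable {S : Set ℕ}

/-- Sums of `k` and of `l` nonzero elements add up to a sum of `k + l` nonzero elements. -/
theorem kfold_add {k l x y : ℕ} (hx : x ∈ kfold S k) (hy : y ∈ kfold S l) :
    x + y ∈ kfold S (k + l) := by
  obtain ⟨c, hc, rfl⟩ := hx
  obtain ⟨d, hd, rfl⟩ := hy
  refine ⟨Fin.append c d, fun i => ?_, by simp [Fin.sum_univ_add]⟩
  induction i using Fin.addCases with
  | left i => simpa using hc i
  | right i => simpa using hd i

theorem mem_kfold_one {s : ℕ} (hs : s ∈ S) (h0 : s ≠ 0) : s ∈ kfold S 1 :=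
  ⟨fun _ => s, fun _ => ⟨hs, h0⟩, by simp⟩

theorem le_of_mem_kfold {k s : ℕ} (h : s ∈ kfold S k) : k ≤ s := by
  obtain ⟨c, hc, rfl⟩ := h
  simpa using Finset.card_nsmul_le_sum Finset.univ c 1
    fun i _ => Nat.one_le_iff_ne_zero.2 (hc i).2

theorem mem_of_mem_kfold (hS : IsNumericalSemigroup S) {k s : ℕ} (h : s ∈ kfold S k) :
    s ∈ S := by
  obtain ⟨c, hc, rfl⟩ := h
  exact Finset.sum_induction c (· ∈ S) hS.2.1 hS.1 fun i _ => (hc i).1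

theorem exists_add_of_mem_kfold_succ {k s : ℕ} (h : s ∈ kfold S (k + 1)) :
    ∃ x ∈ S, x ≠ 0 ∧ ∃ y ∈ kfold S k, x + y = s := by
  obtain ⟨c, hc, rfl⟩ := h
  exact ⟨c 0, (hc 0).1, (hc 0).2, ∑ i : Fin k, c i.succ, ⟨_, fun i => hc i.succ, rfl⟩,
    (Fin.sum_univ_succ c).symm⟩

theorem bddAbove_kfold (s : ℕ) : BddAbove {k | s ∈ kfold S k} :=
  ⟨s, fun _ h => le_of_mem_kfold h⟩

theorem le_ordS {k s : ℕ} (h : s ∈ kfold S k) : k ≤ ordS S s :=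
  le_csSup (bddAbove_kfold s) h

theorem mem_kfold_ordS {s : ℕ} (hs : s ∈ S) : s ∈ kfold S (ordS S s) := by
  refine Nat.sSup_mem (s := {k | s ∈ kfold S k}) ?_ (bddAbove_kfold s)
  rcases eq_or_ne s 0 with rfl | h0
  · exact ⟨0, Fin.elim0, fun i => i.elim0, by simp⟩
  · exact ⟨1, mem_kfold_one hs h0⟩

theorem ordS_add_le {x y : ℕ} (hx : x ∈ S) (hy : y ∈ S) :
    ordS S x + ordS S y ≤ ordS S (x + y) :=
  le_ordS (kfold_add (mem_kfold_ordS hx) (mem_kfold_ordS hy))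

theorem one_le_ordS {s : ℕ} (hs : s ∈ S) (h0 : s ≠ 0) : 1 ≤ ordS S s :=
  le_ordS (mem_kfold_one hs h0)

theorem ordS_lt_of_preceq {u v : ℕ} (hu : u ∈ S) (h : preceq S u v) (hne : v ≠ u) :
    ordS S u < ordS S v := by
  obtain ⟨s, hs, rfl⟩ := h
  have h₁ := ordS_add_le hu hs
  have h₂ := one_le_ordS hs (by rintro rfl; exact hne rfl)
  omega

theorem preceq_of_preceqM {u v : ℕ} (h : preceqM S u v) : preceq S u v := by
  obtain ⟨s, hs, h, -⟩ := h
  exact ⟨s, hs, h⟩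

theorem preceq_trans (hS : IsNumericalSemigroup S) {u v w : ℕ} (h : preceq S u v)
    (h' : preceq S v w) : preceq S u w := by
  obtain ⟨s, hs, rfl⟩ := h
  obtain ⟨t, ht, rfl⟩ := h'
  exact ⟨s + t, hS.2.1 _ _ hs ht, (add_assoc _ _ _).symm⟩

theorem mem_apery_of_preceq (hS : IsNumericalSemigroup S) {n u v : ℕ} (hu : u ∈ S)
    (hv : v ∈ apery S n) (h : preceq S u v) : u ∈ apery S n := by
  obtain ⟨s, hs, rfl⟩ := h
  refine ⟨hu, fun t ht htu => hv.2 (t + s) (hS.2.1 _ _ ht hs) ?_⟩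
  omega

theorem finite_apery (hS : IsNumericalSemigroup S) (n : ℕ) : (apery S n).Finite := by
  refine ((Set.finite_lt_nat n).union (hS.2.2.1.image (· + n))).subset fun w hw => ?_
  rcases lt_or_ge w n with h | h
  · exact Or.inl h
  · exact Or.inr ⟨w - n, fun hmem => hw.2 _ hmem (Nat.sub_add_cancel h), Nat.sub_add_cancel h⟩

theorem exists_preceq_maxAp (hS : IsNumericalSemigroup S) {w : ℕ} (hw : w ∈ apNZ S) :
    ∃ z ∈ maxAp S, preceq S w z := by
  have hfin : {z | z ∈ apNZ S ∧ preceq S w z}.Finite :=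
    (finite_apery hS (mult S)).subset fun z hz => hz.1.1
  obtain ⟨z, ⟨hz, hwz⟩, hmax⟩ := hfin.exists_maximal ⟨w, hw, 0, hS.1, rfl⟩
  refine ⟨z, ⟨hz, fun v hv hzv => ?_⟩, hwz⟩
  have hle : z ≤ v := by
    obtain ⟨s, -, rfl⟩ := hzv
    exact Nat.le_add_right z s
  exact le_antisymm (hmax ⟨hv, preceq_trans hS hwz hzv⟩ hle) hle

/-- An element of order at least two lies strictly `⪯_M`-above a nonzero element of `S`. -/
theorem exists_preceqM_ne (hS : IsNumericalSemigroup S) {w : ℕ} (hw : w ∈ S)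
    (hord : 2 ≤ ordS S w) : ∃ x ∈ S, x ≠ 0 ∧ preceqM S x w ∧ x ≠ w := by
  obtain ⟨k, hk⟩ := Nat.exists_eq_add_of_le' (Nat.one_le_of_lt hord)
  obtain ⟨x, hx, hx0, y, hy, rfl⟩ := exists_add_of_mem_kfold_succ (hk ▸ mem_kfold_ordS hw)
  have hyS := mem_of_mem_kfold hS hy
  have h₁ := ordS_add_le hx hyS
  have h₂ := one_le_ordS hx hx0
  have h₃ := le_ordS hy
  have h₄ := le_of_mem_kfold hy
  exact ⟨x, hx, hx0, ⟨y, hyS, rfl, by omega⟩, by omega⟩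

theorem minAp_eq_minApM (hS : IsNumericalSemigroup S) : minAp S = minApM S := by
  refine Set.Subset.antisymm
    (fun w hw => ⟨hw.1, fun v hv h => hw.2 v hv (preceq_of_preceqM h)⟩)
    fun w hw => ⟨hw.1, fun v hv h => ?_⟩
  by_contra hne
  have h₁ := ordS_lt_of_preceq hv.1.1 h (Ne.symm hne)
  have h₂ := one_le_ordS hv.1.1 hv.2
  obtain ⟨x, hx, hx0, hxw, hxne⟩ := exists_preceqM_ne hS hw.1.1.1 (by omega)
  exact hxne (hw.2 x ⟨mem_apery_of_preceq hS hx hw.1.1 (preceq_of_preceqM hxw), hx0⟩ hxw)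

theorem maxAp_subset_maxApM : maxAp S ⊆ maxApM S :=
  fun _ hw => ⟨hw.1, fun v hv h => hw.2 v hv (preceq_of_preceqM h)⟩

theorem IsMPure.maxApM_subset_maxAp (hS : IsNumericalSemigroup S) (h : IsMPure S) :
    maxApM S ⊆ maxAp S := by
  intro w hw
  obtain ⟨z, hz, hwz⟩ := exists_preceq_maxAp hS hw.1
  by_cases hne : z = w
  · exact hne ▸ hz
  · exact absurd (h w hw z (maxAp_subset_maxApM hz)) (ordS_lt_of_preceq hw.1.1.1 hwz hne).ne

end

/-- relations between `minAp`, `maxAp` and their `M`-versions. -/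
theorem statement9 (S : Set ℕ) (hS : IsNumericalSemigroup S) :
    minAp S = minApM S ∧
    maxAp S ⊆ maxApM S ∧
    (IsMPure S ↔ (IsPure S ∧ maxAp S = maxApM S)) := by
  refine ⟨minAp_eq_minApM hS, maxAp_subset_maxApM, fun h => ⟨fun w hw w' hw' => ?_, ?_⟩, ?_⟩
  · exact h w (maxAp_subset_maxApM hw) w' (maxAp_subset_maxApM hw')
  · exact maxAp_subset_maxApM.antisymm (h.maxApM_subset_maxAp hS)
  · rintro ⟨hpure, heq⟩ w hw w' hw'
    exact hpure w (heq ▸ hw) w' (heq ▸ hw')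

end GotoNS
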